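/- (Lieb's anticommutator inequality, a recast of Hardy's inequality) For every f ∈ C_c^∞(ℝ³) with f ≠ 0 one has Re ∫_{ℝ³} [ \overline{f(x)} (−Δ(|·| f))(x) + |x| \overline{f(x)} (−Δ f)(x) ] dx > 0, i.e. the quadratic form of the anticommutator −Δ|x| + |x|(−Δ) is strictly positive; equivalently −(f, (Δ|x| + |x|Δ)f) = ∫_{ℝ³} |∇(√{|x|} f)(x)|² dx − (1/4)∫_{ℝ³} |f(x)|²/|x|² · |x| dx·(1/|x|) > 0 for f ≠ 0. -/

import Mathlib

open MeasureTheory Real Complex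
open scoped ENNReal NNReal BigOperators ComplexConjugate

noncomputable section

abbrev E3 := EuclideanSpace ℝ (Fin 3)

/-- The Laplacian of a complex-valued function on ℝ³ (pointwise, via iterated
Fréchet derivatives; junk value where not differentiable). -/
def lapC (f : E3 → ℂ) (x : E3) : ℂ :=
  ∑ i : Fin 3,
    fderiv ℝ (fun y => fderiv ℝ f y (EuclideanSpace.single i 1)) x
      (EuclideanSpace.single i 1)

theorem integrableOn_inv_norm_ball (r : ℝ) :
    IntegrableOn (fun x : E3 => ‖x‖⁻¹) (Metric.ball 0 r) := by
  have h := (integrableOn_fun_norm_addHaar (E := E3) volume (f := fun y : ℝ => y⁻¹) (r := r)).2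
  refine h ?_
  have hc : IntegrableOn (fun y : ℝ => y) (Set.Ioo 0 r) :=
    (continuous_id.integrableOn_Icc (a := 0) (b := r)).mono_set Set.Ioo_subset_Icc_self
  refine hc.congr_fun (fun y hy => ?_) measurableSet_Ioo
  have : y ≠ 0 := hy.1.ne'
  simp
  field_simp

theorem integrable_inv_norm_smul {F : Type*} [NormedAddCommGroup F] [NormedSpace ℝ F]
    {h : E3 → F} (hc : Continuous h) (hs : HasCompactSupport h) :
    Integrable (fun x => ‖x‖⁻¹ • h x) := by
  obtain ⟨C, hC⟩ := hs.exists_bound_of_continuous hc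
  obtain ⟨r, hr⟩ := hs.isCompact.isBounded.subset_ball 0
  have hI : Integrable ((Metric.ball (0 : E3) r).indicator fun x => C * ‖x‖⁻¹) :=
    IntegrableOn.integrable_indicator ((integrableOn_inv_norm_ball r).const_mul C)
      measurableSet_ball
  refine hI.mono' ?_ (Filter.Eventually.of_forall fun x => ?_)
  · exact (measurable_norm.inv.aestronglyMeasurable).smul
      (hc.integrable_of_hasCompactSupport hs).aestronglyMeasurable
  · by_cases hx : x ∈ Metric.ball (0 : E3) r
    · rw [Set.indicator_of_mem hx, norm_smul, norm_inv, norm_norm, mul_comm]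
      exact mul_le_mul_of_nonneg_right (hC x) (by positivity)
    · rw [Set.indicator_of_notMem hx, image_eq_zero_of_notMem_tsupport fun h' => hx (hr h')]
      simp

theorem integrable_norm_mul {h : E3 → ℝ} (hc : Continuous h) (hs : HasCompactSupport h) :
    Integrable (fun x => ‖x‖ * h x) :=
  (continuous_norm.mul hc).integrable_of_hasCompactSupport (hs.mul_left)

theorem hasFDerivAt_norm_of_ne_zero {x : E3} (hx : x ≠ 0) :
    HasFDerivAt (fun y : E3 => ‖y‖) (‖x‖⁻¹ • innerSL ℝ x) x := by
  have h := (hasStrictFDerivAt_norm_sq x).hasFDerivAt.sqrt (by positivity)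
  simp only [Real.sqrt_sq (norm_nonneg _)] at h
  refine h.congr_fderiv ?_
  ext v
  simp
  ring

theorem fderiv_apply_self_eq_sum {F : Type*} [NormedAddCommGroup F] [NormedSpace ℝ F]
    (L : E3 →L[ℝ] F) (x : E3) :
    L x = ∑ i, x i • L (EuclideanSpace.single i 1) := by
  conv_lhs => rw [← (EuclideanSpace.basisFun (Fin 3) ℝ).sum_repr x]
  simp

/-- Euler's identity in weak form, against the weight `‖x‖⁻¹`, which is homogeneous of degree `-1`
in dimension three. -/
theorem integral_inv_norm_mul_fderiv_self {g : E3 → ℝ} (hg : ContDiff ℝ 1 g)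
    (hs : HasCompactSupport g) :
    ∫ x, ‖x‖⁻¹ * fderiv ℝ g x x = -2 * ∫ x, ‖x‖⁻¹ * g x := by
  have hd : Continuous (fderiv ℝ g) := hg.continuous_fderiv (by simp)
  have hds : HasCompactSupport (fderiv ℝ g) := hs.fderiv ℝ
  obtain ⟨C, hC⟩ := hds.exists_bound_of_continuous hd
  obtain ⟨r, hr⟩ := hds.isCompact.isBounded.subset_ball 0
  have key := (hasDerivAt_integral_of_dominated_loc_of_deriv_le (μ := (volume : Measure E3))
    (F := fun (t : ℝ) x => ‖x‖⁻¹ * g (t • x))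
    (F' := fun (t : ℝ) x => ‖x‖⁻¹ * fderiv ℝ g (t • x) x) (x₀ := 1)
    (s := Set.Ioi (1 / 2 : ℝ))
    (bound := (Metric.ball (0 : E3) (2 * r)).indicator fun _ => C)
    (Ioi_mem_nhds (by norm_num)) ?_ ?_ ?_ ?_ ?_ ?_).2
  · have hscale : ∀ t : ℝ, 0 < t →
        ∫ x : E3, ‖x‖⁻¹ * g (t • x) = t⁻¹ ^ 2 * ∫ x : E3, ‖x‖⁻¹ * g x := by
      intro t ht
      have h1 := Measure.integral_comp_smul_of_nonneg (volume : Measure E3)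
        (fun x => ‖x‖⁻¹ * g x) t (hR := ht.le)
      have h2 : ∀ x : E3, ‖x‖⁻¹ * g (t • x) = t * (‖t • x‖⁻¹ * g (t • x)) := by
        intro x
        rw [norm_smul, Real.norm_of_nonneg ht.le, mul_inv]
        field_simp
      simp_rw [h2]
      rw [integral_const_mul, h1]
      simp
      field_simp
    have h3 : HasDerivAt (fun t : ℝ => t⁻¹ ^ 2 * ∫ x : E3, ‖x‖⁻¹ * g x)
        (-2 * ∫ x : E3, ‖x‖⁻¹ * g x) 1 := by
      have := ((hasDerivAt_inv (one_ne_zero (α := ℝ))).pow 2).mul_const (∫ x : E3, ‖x‖⁻¹ * g x)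
      exact this.congr_deriv (by norm_num)
    have h4 := h3.congr_of_eventuallyEq (f₁ := fun t : ℝ => ∫ x : E3, ‖x‖⁻¹ * g (t • x)) (by
      filter_upwards [Ioi_mem_nhds (zero_lt_one (α := ℝ))] with t ht using hscale t ht)
    simpa using key.unique h4
  · refine Filter.Eventually.of_forall fun t => ?_
    exact (measurable_norm.inv.mul
      (hg.continuous.comp (continuous_const_smul t)).measurable).aestronglyMeasurable
  · simpa using integrable_inv_norm_smul hg.continuous hs
  · simp only [one_smul]
    exact (measurable_norm.inv.mul (hd.clm_apply continuous_id).measurable).aestronglyMeasurable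
  · refine Filter.Eventually.of_forall fun x t ht => ?_
    have ht : 1 / 2 < t := ht
    by_cases hx : x ∈ Metric.ball (0 : E3) (2 * r)
    · rw [Set.indicator_of_mem hx, norm_mul, norm_inv, norm_norm]
      rcases eq_or_ne x 0 with rfl | h0
      · simpa using (norm_nonneg _).trans (hC 0)
      · have hp : 0 < ‖x‖ := norm_pos_iff.2 h0
        rw [inv_mul_le_iff₀ hp, mul_comm]
        exact ((fderiv ℝ g (t • x)).le_opNorm x).trans
          (mul_le_mul_of_nonneg_right (hC _) hp.le)
    · rw [Set.indicator_of_notMem hx, image_eq_zero_of_notMem_tsupport (f := fderiv ℝ g)]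
      · simp
      · intro h'
        apply hx
        have := hr h'
        rw [mem_ball_zero_iff, norm_smul, Real.norm_of_nonneg (by linarith)] at this
        rw [mem_ball_zero_iff]
        nlinarith [norm_nonneg x]
  · exact (integrable_indicator_iff measurableSet_ball).2
      (integrableOn_const measure_ball_lt_top.ne)
  · refine Filter.Eventually.of_forall fun x t _ => ?_
    have h1 : HasDerivAt (fun t : ℝ => t • x) x t := by
      simpa using (hasDerivAt_id t).smul_const x
    exact (((hg.differentiable (by simp)) (t • x)).hasFDerivAt.comp_hasDerivAt t h1).const_mul _

theorem hasFDerivAt_norm_smul {f : E3 → ℂ} {x : E3} (hf : DifferentiableAt ℝ f x) (hx : x ≠ 0) :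
    HasFDerivAt (fun y => ‖y‖ • f y)
      (‖x‖ • fderiv ℝ f x + (‖x‖⁻¹ • innerSL ℝ x).smulRight (f x)) x :=
  (hasFDerivAt_norm_of_ne_zero hx).smul hf.hasFDerivAt

theorem fderiv_norm_smul_single {f : E3 → ℂ} {x : E3} (hf : DifferentiableAt ℝ f x) (hx : x ≠ 0)
    (i : Fin 3) :
    fderiv ℝ (fun y => ‖y‖ • f y) x (EuclideanSpace.single i 1) =
      ‖x‖ • fderiv ℝ f x (EuclideanSpace.single i 1) + (‖x‖⁻¹ * x i) • f x := by
  rw [(hasFDerivAt_norm_smul hf hx).fderiv]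
  simp [EuclideanSpace.inner_single_right]

theorem lapC_norm_smul {f : E3 → ℂ} (hf : ContDiff ℝ 2 f) {x : E3} (hx : x ≠ 0) :
    lapC (fun y => ‖y‖ • f y) x =
      ‖x‖ • lapC f x + (2 * ‖x‖⁻¹) • (fderiv ℝ f x x + f x) := by
  have hd : Differentiable ℝ f := hf.differentiable (by simp)
  have hd2 : Differentiable ℝ (fderiv ℝ f) :=
    (hf.fderiv_right (m := 1) (by norm_num)).differentiable (by simp)
  have hterm : ∀ i : Fin 3,
      fderiv ℝ (fun y => fderiv ℝ (fun y => ‖y‖ • f y) y (EuclideanSpace.single i 1)) x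
        (EuclideanSpace.single i 1) =
      ‖x‖ • fderiv ℝ (fun y => fderiv ℝ f y (EuclideanSpace.single i 1)) x
          (EuclideanSpace.single i 1)
        + (2 * ‖x‖⁻¹) • (x i • fderiv ℝ f x (EuclideanSpace.single i 1))
        + (‖x‖⁻¹ - x i ^ 2 * ‖x‖⁻¹ ^ 3) • f x := by
    intro i
    have hev : (fun y => fderiv ℝ (fun y => ‖y‖ • f y) y (EuclideanSpace.single i 1)) =ᶠ[nhds x]
        fun y => ‖y‖ • fderiv ℝ f y (EuclideanSpace.single i 1) + (‖y‖⁻¹ * y i) • f y := by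
      filter_upwards [isOpen_ne.mem_nhds hx] with y hy
      exact fderiv_norm_smul_single (hd y) hy i
    have hdi : DifferentiableAt ℝ (fun y => fderiv ℝ f y (EuclideanSpace.single i 1)) x :=
      (hd2 x).clm_apply (differentiableAt_const _)
    have hN := hasFDerivAt_norm_of_ne_zero hx
    have hinv := (hasDerivAt_inv (norm_ne_zero_iff.2 hx)).comp_hasFDerivAt x hN
    have hproj : HasFDerivAt (fun y : E3 => y i) (EuclideanSpace.proj (𝕜 := ℝ) i) x :=
      (EuclideanSpace.proj (𝕜 := ℝ) i : E3 →L[ℝ] ℝ).hasFDerivAt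
    have hsum := (hasFDerivAt_norm_smul hdi hx).add ((hinv.mul hproj).smul (hd x).hasFDerivAt)
    rw [hev.fderiv_eq]
    refine (congrArg (fun L : E3 →L[ℝ] ℂ => L (EuclideanSpace.single i 1)) hsum.fderiv).trans ?_
    simp [EuclideanSpace.inner_single_right]
    ring
  have hn : (x 0 ^ 2 + x 1 ^ 2 + x 2 ^ 2) = ‖x‖ ^ 2 := by
    rw [EuclideanSpace.real_norm_sq_eq, Fin.sum_univ_three]
  have hx' : ‖x‖ ≠ 0 := norm_ne_zero_iff.2 hx
  have hcoef : ((‖x‖⁻¹ - x 0 ^ 2 * ‖x‖⁻¹ ^ 3) + (‖x‖⁻¹ - x 1 ^ 2 * ‖x‖⁻¹ ^ 3)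
      + (‖x‖⁻¹ - x 2 ^ 2 * ‖x‖⁻¹ ^ 3)) = 2 * ‖x‖⁻¹ := by
    have : 3 * ‖x‖⁻¹ - (x 0 ^ 2 + x 1 ^ 2 + x 2 ^ 2) * ‖x‖⁻¹ ^ 3 = 2 * ‖x‖⁻¹ := by
      rw [hn]; field_simp; norm_num
    linarith
  rw [fderiv_apply_self_eq_sum, smul_add]
  nth_rewrite 2 [← hcoef]
  simp only [lapC, hterm, Fin.sum_univ_three]
  module

theorem hasFDerivAt_sqrt_norm_smul {f : E3 → ℂ} {x : E3} (hf : DifferentiableAt ℝ f x)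
    (hx : x ≠ 0) :
    HasFDerivAt (fun y => √‖y‖ • f y)
      (√‖x‖ • fderiv ℝ f x + ((1 / (2 * √‖x‖)) • ‖x‖⁻¹ • innerSL ℝ x).smulRight (f x)) x :=
  ((hasFDerivAt_norm_of_ne_zero hx).sqrt (norm_ne_zero_iff.2 hx)).smul hf.hasFDerivAt

theorem sum_norm_sq_smul_add (v : Fin 3 → ℂ) (w : ℂ) (x : E3) (a b : ℝ) :
    ∑ i, ‖a • v i + (b * x i) • w‖ ^ 2 =
      a ^ 2 * ∑ i, ‖v i‖ ^ 2 + 2 * a * b * inner ℝ w (∑ i, x i • v i)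
        + b ^ 2 * ‖x‖ ^ 2 * ‖w‖ ^ 2 := by
  simp only [norm_add_sq_real, norm_smul, EuclideanSpace.real_norm_sq_eq, Fin.sum_univ_three,
    inner_add_right, real_inner_smul_right, mul_pow, Real.norm_eq_abs, sq_abs,
    real_inner_comm w]
  ring

/-- The squared Euclidean length of the complex gradient. -/
def gradSq (f : E3 → ℂ) (x : E3) : ℝ :=
  ∑ i, ‖fderiv ℝ f x (EuclideanSpace.single i 1)‖ ^ 2

theorem gradSq_sqrt_norm_smul {f : E3 → ℂ} {x : E3} (hf : DifferentiableAt ℝ f x) (hx : x ≠ 0) :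
    gradSq (fun y => √‖y‖ • f y) x =
      ‖x‖ * gradSq f x + ‖x‖⁻¹ * inner ℝ (f x) (fderiv ℝ f x x)
        + 1 / 4 * (‖x‖⁻¹ * ‖f x‖ ^ 2) := by
  have hx' : 0 < ‖x‖ := norm_pos_iff.2 hx
  have hs : √‖x‖ ^ 2 = ‖x‖ := Real.sq_sqrt hx'.le
  have hs0 : √‖x‖ ≠ 0 := (Real.sqrt_pos.2 hx').ne'
  have h := sum_norm_sq_smul_add (fun i => fderiv ℝ f x (EuclideanSpace.single i 1)) (f x) x
    √‖x‖ (1 / (2 * √‖x‖) * ‖x‖⁻¹)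
  rw [← fderiv_apply_self_eq_sum, ← gradSq, hs] at h
  rw [gradSq, (hasFDerivAt_sqrt_norm_smul hf hx).fderiv]
  convert h using 1
  · refine Finset.sum_congr rfl fun i _ => ?_
    simp [EuclideanSpace.inner_single_right, mul_assoc]
  · have h1 : 2 * √‖x‖ * (1 / (2 * √‖x‖) * ‖x‖⁻¹) = ‖x‖⁻¹ := by field_simp
    have h2 : (1 / (2 * √‖x‖) * ‖x‖⁻¹) ^ 2 * ‖x‖ ^ 2 = 1 / 4 * ‖x‖⁻¹ := by
      rw [mul_pow, div_pow, mul_pow, hs]; field_simp; norm_num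
    rw [h1, h2]; ring

/-- Integration by parts against the Lipschitz weight `‖x‖`. -/
theorem integral_norm_mul_fderiv_single {h : E3 → ℝ} (hh : ContDiff ℝ 1 h)
    (hs : HasCompactSupport h) (i : Fin 3) :
    ∫ x, ‖x‖ * fderiv ℝ h x (EuclideanSpace.single i 1) = -∫ x, ‖x‖⁻¹ * (x i * h x) := by
  obtain ⟨C, hC⟩ := hh.lipschitzWith_of_hasCompactSupport hs (by simp)
  have key := LipschitzWith.integral_lineDeriv_mul_eq (μ := (volume : Measure E3))
    lipschitzWith_one_norm hC hs (EuclideanSpace.single i (1 : ℝ))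
  have hl : (fun x => lineDeriv ℝ (fun y : E3 => ‖y‖) x (EuclideanSpace.single i 1) * h x)
      =ᵐ[volume] fun x => ‖x‖⁻¹ * (x i * h x) := by
    filter_upwards [Measure.ae_ne volume (0 : E3)] with x hx
    rw [(hasFDerivAt_norm_of_ne_zero hx).differentiableAt.lineDeriv_eq_fderiv,
      (hasFDerivAt_norm_of_ne_zero hx).fderiv]
    simp [EuclideanSpace.inner_single_right, mul_assoc]
  have hr : ∀ x, lineDeriv ℝ h x (-EuclideanSpace.single i 1) * ‖x‖
      = -(‖x‖ * fderiv ℝ h x (EuclideanSpace.single i 1)) := by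
    intro x
    rw [((hh.differentiable (by simp)) x).lineDeriv_eq_fderiv, map_neg]
    ring
  simp_rw [hr] at key
  rw [integral_congr_ae hl, integral_neg] at key
  linarith

theorem eq_zero_of_fderiv_self_add_eq_zero {f : E3 → ℂ} (hf : ContDiff ℝ 1 f)
    (hs : HasCompactSupport f) (h : ∀ x, x ≠ 0 → fderiv ℝ f x x + f x = 0) : f = 0 := by
  have hd := hf.differentiable (by simp)
  have hne : ∀ x : E3, x ≠ 0 → f x = 0 := by
    intro x hx
    have hderiv : ∀ t : ℝ, HasDerivAt (fun t : ℝ => t • f (t • x))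
        (t • fderiv ℝ f (t • x) x + f (t • x)) t := by
      intro t
      have h1 : HasDerivAt (fun t : ℝ => t • x) x t := by
        simpa using (hasDerivAt_id t).smul_const x
      exact ((hasDerivAt_id t).smul ((hd (t • x)).hasFDerivAt.comp_hasDerivAt t h1)).congr_deriv
        (by simp)
    have hzero : ∀ t ∈ Set.Ioi (0 : ℝ), deriv (fun t : ℝ => t • f (t • x)) t = 0 := by
      intro t ht
      rw [(hderiv t).deriv, ← map_smul]
      exact h _ (smul_ne_zero (ne_of_gt ht) hx)
    obtain ⟨r, hr⟩ := hs.isCompact.isBounded.subset_ball 0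
    have hx' : 0 < ‖x‖ := norm_pos_iff.2 hx
    set T : ℝ := |r| / ‖x‖ + 1 with hT
    have hTpos : 0 < T := by positivity
    have hfT : f (T • x) = 0 := by
      apply image_eq_zero_of_notMem_tsupport
      intro hmem
      have h2 := hr hmem
      rw [mem_ball_zero_iff, norm_smul, Real.norm_of_nonneg hTpos.le, hT, add_mul,
        div_mul_cancel₀ _ hx'.ne'] at h2
      linarith [le_abs_self r]
    have hconst := (convex_Ioi (0 : ℝ)).is_const_of_fderivWithin_eq_zero (𝕜 := ℝ)
      (f := fun t : ℝ => t • f (t • x))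
      (fun t _ => (hderiv t).differentiableAt.differentiableWithinAt) (by
        intro t ht
        rw [fderivWithin_of_isOpen isOpen_Ioi ht]
        ext
        simpa using hzero t ht) (Set.mem_Ioi.2 one_pos) (Set.mem_Ioi.2 hTpos)
    simpa [hfT] using hconst
  have hae : f =ᵐ[volume] (0 : E3 → ℂ) := by
    filter_upwards [Measure.ae_ne volume (0 : E3)] with x hx using hne x hx
  exact (Continuous.ae_eq_iff_eq volume hf.continuous continuous_zero).1 hae

section IntegralIdentities

variable {f : E3 → ℂ}

theorem continuous_gradSq (hf : ContDiff ℝ 1 f) : Continuous (gradSq f) := by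
  have hd : Continuous (fderiv ℝ f) := hf.continuous_fderiv (by simp)
  exact continuous_finsetSum _ fun i _ => (hd.clm_apply continuous_const).norm.pow 2

theorem hasCompactSupport_gradSq (hs : HasCompactSupport f) : HasCompactSupport (gradSq f) := by
  refine (hs.fderiv ℝ).mono fun x hx => ?_
  contrapose! hx
  simp only [Function.mem_support, not_not] at hx ⊢
  simp [gradSq, hx]

theorem continuous_lapC (hf : ContDiff ℝ 2 f) : Continuous (lapC f) := by
  refine continuous_finsetSum _ fun i _ => ?_
  have h1 : ContDiff ℝ 1 fun y => fderiv ℝ f y (EuclideanSpace.single i 1) :=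
    (hf.fderiv_right (m := 1) (by norm_num)).clm_apply contDiff_const
  exact (h1.continuous_fderiv (by simp)).clm_apply continuous_const

theorem HasCompactSupport.inner_left {g : E3 → ℂ} (hs : HasCompactSupport f) :
    HasCompactSupport fun x => inner ℝ (f x) (g x) := by
  refine hs.mono fun x hx => ?_
  contrapose! hx
  simp only [Function.mem_support, not_not] at hx ⊢
  simp [hx]

theorem integrable_inv_norm_mul_norm_sq (hf : Continuous f) (hs : HasCompactSupport f) :
    Integrable fun x => ‖x‖⁻¹ * ‖f x‖ ^ 2 :=
  integrable_inv_norm_smul (h := fun x => ‖f x‖ ^ 2) (hf.norm.pow 2)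
    (hs.comp_left (g := fun z => ‖z‖ ^ 2) (by simp))

theorem integrable_inv_norm_mul_inner_fderiv_self (hf : ContDiff ℝ 1 f)
    (hs : HasCompactSupport f) :
    Integrable fun x => ‖x‖⁻¹ * inner ℝ (f x) (fderiv ℝ f x x) :=
  integrable_inv_norm_smul (h := fun x => inner ℝ (f x) (fderiv ℝ f x x))
    (hf.continuous.inner ((hf.continuous_fderiv (by simp)).clm_apply continuous_id)) hs.inner_left

theorem integrable_norm_mul_gradSq (hf : ContDiff ℝ 1 f) (hs : HasCompactSupport f) :
    Integrable fun x => ‖x‖ * gradSq f x :=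
  integrable_norm_mul (continuous_gradSq hf) (hasCompactSupport_gradSq hs)

theorem integral_inv_norm_mul_inner_fderiv_self (hf : ContDiff ℝ 1 f) (hs : HasCompactSupport f) :
    ∫ x, ‖x‖⁻¹ * inner ℝ (f x) (fderiv ℝ f x x) = -∫ x, ‖x‖⁻¹ * ‖f x‖ ^ 2 := by
  have hsq : HasCompactSupport fun x => ‖f x‖ ^ 2 := hs.comp_left (g := fun z => ‖z‖ ^ 2) (by simp)
  have h := integral_inv_norm_mul_fderiv_self (hf.norm_sq ℝ) hsq
  have hterm : ∀ x, ‖x‖⁻¹ * fderiv ℝ (fun x => ‖f x‖ ^ 2) x x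
      = 2 * (‖x‖⁻¹ * inner ℝ (f x) (fderiv ℝ f x x)) := by
    intro x
    rw [((hf.differentiable (by simp)) x).hasFDerivAt.norm_sq.fderiv]
    simp
    ring
  simp_rw [hterm] at h
  rw [integral_const_mul] at h
  linarith

/-- Green's identity with weight `‖x‖`. -/
theorem integral_norm_mul_inner_lapC (hf : ContDiff ℝ 2 f) (hs : HasCompactSupport f) :
    ∫ x, ‖x‖ * inner ℝ (f x) (lapC f x) =
      -(∫ x, ‖x‖ * gradSq f x) - ∫ x, ‖x‖⁻¹ * inner ℝ (f x) (fderiv ℝ f x x) := by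
  have hd : Differentiable ℝ f := hf.differentiable (by simp)
  have hf1 : ContDiff ℝ 1 f := hf.of_le (by norm_num)
  set d : Fin 3 → E3 → ℂ := fun i x => fderiv ℝ f x (EuclideanSpace.single i 1) with hd_def
  set h : Fin 3 → E3 → ℝ := fun i x => inner ℝ (f x) (d i x) with hh_def
  have hdc : ∀ i, ContDiff ℝ 1 (d i) := fun i =>
    (hf.fderiv_right (m := 1) (by norm_num)).clm_apply contDiff_const
  have hhc : ∀ i, ContDiff ℝ 1 (h i) := fun i => hf1.inner ℝ (hdc i)
  have hhs : ∀ i, HasCompactSupport (h i) := fun i => hs.inner_left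
  have hderiv : ∀ i x, fderiv ℝ (h i) x (EuclideanSpace.single i 1) =
      ‖d i x‖ ^ 2 + inner ℝ (f x) (fderiv ℝ (d i) x (EuclideanSpace.single i 1)) := by
    intro i x
    rw [fderiv_inner_apply ℝ (hd x) ((hdc i).differentiable (by simp) x), add_comm,
      ← real_inner_self_eq_norm_sq]
  have hI : ∀ i, Integrable fun x => ‖x‖ * fderiv ℝ (h i) x (EuclideanSpace.single i 1) :=
    fun i => integrable_norm_mul (((hhc i).continuous_fderiv (by simp)).clm_apply continuous_const)
      ((hhs i).fderiv_apply ℝ _)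
  have hJ : ∀ i, Integrable fun x : E3 => ‖x‖⁻¹ * (x i * h i x) := fun i =>
    integrable_inv_norm_smul (h := fun x : E3 => x i * h i x)
      ((EuclideanSpace.proj (𝕜 := ℝ) i : E3 →L[ℝ] ℝ).continuous.mul (hhc i).continuous)
      ((hhs i).mul_left)
  have hleft : ∀ x, ‖x‖ * inner ℝ (f x) (lapC f x) =
      (∑ i, ‖x‖ * fderiv ℝ (h i) x (EuclideanSpace.single i 1)) - ‖x‖ * gradSq f x := by
    intro x
    simp only [hderiv, lapC, gradSq, Fin.sum_univ_three, inner_add_right, hd_def]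
    ring
  have hright : ∀ x : E3, ‖x‖⁻¹ * inner ℝ (f x) (fderiv ℝ f x x) =
      ∑ i, ‖x‖⁻¹ * (x i * h i x) := by
    intro x
    rw [fderiv_apply_self_eq_sum, inner_sum, Finset.mul_sum]
    simp only [hh_def, real_inner_smul_right, hd_def]
  simp_rw [hleft, hright]
  rw [integral_sub (integrable_finsetSum _ fun i _ => hI i)
      (integrable_norm_mul_gradSq hf1 hs),
    integral_finsetSum _ fun i _ => hI i, integral_finsetSum _ fun i _ => hJ i]
  simp_rw [integral_norm_mul_fderiv_single (hhc _) (hhs _)]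
  rw [Finset.sum_neg_distrib]
  ring

/-- The strict Hardy inequality with weight `‖x‖`. -/
theorem integral_inv_norm_mul_norm_sq_lt (hf : ContDiff ℝ 1 f) (hs : HasCompactSupport f)
    (hne : f ≠ 0) :
    ∫ x, ‖x‖⁻¹ * ‖f x‖ ^ 2 < ∫ x, ‖x‖ * gradSq f x := by
  have hd : Continuous (fderiv ℝ f) := hf.continuous_fderiv (by simp)
  have hG : Integrable fun x => ‖x‖ * gradSq f x :=
    integrable_norm_mul_gradSq hf hs
  have hV : Integrable fun x => ‖x‖⁻¹ * ‖f x‖ ^ 2 :=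
    integrable_inv_norm_mul_norm_sq hf.continuous hs
  have hP : Integrable fun x => ‖x‖⁻¹ * inner ℝ (f x) (fderiv ℝ f x x) :=
    integrable_inv_norm_mul_inner_fderiv_self hf hs
  set S : E3 → ℝ := fun x =>
    ‖x‖ * gradSq f x + 2 * (‖x‖⁻¹ * inner ℝ (f x) (fderiv ℝ f x x)) + ‖x‖⁻¹ * ‖f x‖ ^ 2 with hS
  have hSint : Integrable S := (hG.add (hP.const_mul 2)).add hV
  have hSeq : ∫ x, S x = (∫ x, ‖x‖ * gradSq f x) - ∫ x, ‖x‖⁻¹ * ‖f x‖ ^ 2 := by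
    have h1 := integral_add (hG.add (hP.const_mul 2)) hV
    have h2 := integral_add hG (hP.const_mul 2)
    rw [integral_const_mul, integral_inv_norm_mul_inner_fderiv_self hf hs] at h2
    simp only [Pi.add_apply] at h1
    rw [hS, h1, h2]
    ring
  have hSsq : ∀ x, x ≠ 0 → ‖x‖ ^ 3 * S x =
      ∑ i, ‖(‖x‖ ^ 2) • fderiv ℝ f x (EuclideanSpace.single i 1) + x i • f x‖ ^ 2 := by
    intro x hx
    have hx' : ‖x‖ ≠ 0 := norm_ne_zero_iff.2 hx
    have h := sum_norm_sq_smul_add (fun i => fderiv ℝ f x (EuclideanSpace.single i 1)) (f x) x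
      (‖x‖ ^ 2) 1
    rw [← fderiv_apply_self_eq_sum, ← gradSq] at h
    simp only [one_mul] at h
    rw [h, hS]
    field_simp
  have hSnn : 0 ≤ᵐ[volume] S := by
    filter_upwards [Measure.ae_ne volume (0 : E3)] with x hx
    have hx' : 0 < ‖x‖ := norm_pos_iff.2 hx
    refine nonneg_of_mul_nonneg_right (a := ‖x‖ ^ 3) ?_ (by positivity)
    rw [hSsq x hx]
    positivity
  have hpos : 0 < ∫ x, S x := by
    refine (integral_nonneg_of_ae hSnn).lt_of_ne' fun h0 => hne ?_
    have hS0 := (integral_eq_zero_iff_of_nonneg_ae hSnn hSint).1 h0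
    have hcomp : ∀ i x,
        (‖x‖ ^ 2) • fderiv ℝ f x (EuclideanSpace.single i 1) + x i • f x = 0 := by
      intro i
      have hae : (fun x : E3 => (‖x‖ ^ 2) • fderiv ℝ f x (EuclideanSpace.single i 1) + x i • f x)
          =ᵐ[volume] fun _ => 0 := by
        filter_upwards [hS0, Measure.ae_ne volume (0 : E3)] with x hx0 hx
        have h := hSsq x hx
        rw [hx0, Pi.zero_apply, mul_zero, eq_comm,
          Finset.sum_eq_zero_iff_of_nonneg fun i _ => by positivity] at h
        simpa using h i (Finset.mem_univ i)
      refine congrFun ((Continuous.ae_eq_iff_eq volume ?_ continuous_const).1 hae)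
      exact ((continuous_norm.pow 2).smul (hd.clm_apply continuous_const)).add
        ((EuclideanSpace.proj (𝕜 := ℝ) i : E3 →L[ℝ] ℝ).continuous.smul hf.continuous)
    refine eq_zero_of_fderiv_self_add_eq_zero hf hs fun x hx => ?_
    have h : (‖x‖ ^ 2) • (fderiv ℝ f x x + f x) = 0 := by
      have h2 : ∑ i, x i • ((‖x‖ ^ 2) • fderiv ℝ f x (EuclideanSpace.single i 1) + x i • f x) = 0 :=
        Finset.sum_eq_zero fun i _ => by rw [hcomp, smul_zero]
      rw [← h2, smul_add, fderiv_apply_self_eq_sum]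
      nth_rewrite 2 [EuclideanSpace.real_norm_sq_eq]
      simp only [Fin.sum_univ_three]
      module
    exact (smul_eq_zero.1 h).resolve_left (pow_ne_zero 2 (norm_ne_zero_iff.2 hx))
  linarith

theorem integral_anticommutator_re (hf : ContDiff ℝ 2 f) (hs : HasCompactSupport f) :
    (∫ x : E3,
      ((starRingEnd ℂ) (f x) * (-(lapC (fun y : E3 => (‖y‖ : ℂ) * f y) x))
        + (‖x‖ : ℂ) * (starRingEnd ℂ) (f x) * (-(lapC f x)))).re =
      2 * ((∫ x, ‖x‖ * gradSq f x) - ∫ x, ‖x‖⁻¹ * ‖f x‖ ^ 2) := by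
  have hf1 : ContDiff ℝ 1 f := hf.of_le (by norm_num)
  have hd : Continuous (fderiv ℝ f) := hf1.continuous_fderiv (by simp)
  have hconj : Continuous fun x => (starRingEnd ℂ) (f x) := continuous_conj.comp hf.continuous
  have hconjs : HasCompactSupport fun x => (starRingEnd ℂ) (f x) := hs.comp_left (map_zero _)
  set A : E3 → ℂ := fun x => (starRingEnd ℂ) (f x) * lapC f x with hA
  set B : E3 → ℂ := fun x => (starRingEnd ℂ) (f x) * (fderiv ℝ f x x + f x) with hB
  have hAi : Integrable fun x => ‖x‖ • A x :=
    (continuous_norm.smul (hconj.mul (continuous_lapC hf))).integrable_of_hasCompactSupport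
      (hconjs.mul_right).smul_left
  have hBi : Integrable fun x => ‖x‖⁻¹ • B x :=
    integrable_inv_norm_smul (hconj.mul ((hd.clm_apply continuous_id).add hf.continuous))
      hconjs.mul_right
  have hae : (fun x : E3 => (starRingEnd ℂ) (f x) * (-(lapC (fun y : E3 => (‖y‖ : ℂ) * f y) x))
        + (‖x‖ : ℂ) * (starRingEnd ℂ) (f x) * (-(lapC f x))) =ᵐ[volume]
      fun x => (-2 : ℝ) • (‖x‖ • A x + ‖x‖⁻¹ • B x) := by
    filter_upwards [Measure.ae_ne volume (0 : E3)] with x hx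
    have h := lapC_norm_smul hf hx
    simp only [Complex.real_smul] at h
    rw [h]
    simp only [hA, hB, Complex.real_smul]
    push_cast
    ring
  have hre : ∀ x, ((-2 : ℝ) • (‖x‖ • A x + ‖x‖⁻¹ • B x)).re =
      -2 * (‖x‖ * inner ℝ (f x) (lapC f x) + ‖x‖⁻¹ * inner ℝ (f x) (fderiv ℝ f x x)
        + ‖x‖⁻¹ * ‖f x‖ ^ 2) := by
    intro x
    rw [← real_inner_self_eq_norm_sq]
    simp only [hA, hB, Complex.inner, Complex.smul_re, Complex.add_re, mul_add, smul_eq_mul,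
      mul_comm _ ((starRingEnd ℂ) (f x))]
    ring
  have hL : Integrable fun x => ‖x‖ * inner ℝ (f x) (lapC f x) :=
    integrable_norm_mul (hf.continuous.inner (continuous_lapC hf)) hs.inner_left
  have hP : Integrable fun x => ‖x‖⁻¹ * inner ℝ (f x) (fderiv ℝ f x x) :=
    integrable_inv_norm_mul_inner_fderiv_self hf1 hs
  have hV : Integrable fun x => ‖x‖⁻¹ * ‖f x‖ ^ 2 :=
    integrable_inv_norm_mul_norm_sq hf.continuous hs
  have hAB : Integrable fun x => (-2 : ℝ) • (‖x‖ • A x + ‖x‖⁻¹ • B x) :=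
    (hAi.add hBi).smul (-2 : ℝ)
  have hLP : Integrable fun x =>
      ‖x‖ * inner ℝ (f x) (lapC f x) + ‖x‖⁻¹ * inner ℝ (f x) (fderiv ℝ f x x) := hL.add hP
  rw [integral_congr_ae hae, ← Complex.reCLM_apply, ← ContinuousLinearMap.integral_comp_comm _ hAB]
  simp only [Complex.reCLM_apply, hre]
  rw [integral_const_mul, integral_add hLP hV, integral_add hL hP,
    integral_norm_mul_inner_lapC hf hs, integral_inv_norm_mul_inner_fderiv_self hf1 hs]
  ring

theorem integral_gradSq_sqrt_norm_smul (hf : ContDiff ℝ 1 f) (hs : HasCompactSupport f) :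
    ∫ x, gradSq (fun y => √‖y‖ • f y) x =
      (∫ x, ‖x‖ * gradSq f x) - 3 / 4 * ∫ x, ‖x‖⁻¹ * ‖f x‖ ^ 2 := by
  have hG : Integrable fun x => ‖x‖ * gradSq f x :=
    integrable_norm_mul_gradSq hf hs
  have hP := integrable_inv_norm_mul_inner_fderiv_self hf hs
  have hV := integrable_inv_norm_mul_norm_sq hf.continuous hs
  have hae : gradSq (fun y => √‖y‖ • f y) =ᵐ[volume] fun x =>
      ‖x‖ * gradSq f x + ‖x‖⁻¹ * inner ℝ (f x) (fderiv ℝ f x x)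
        + 1 / 4 * (‖x‖⁻¹ * ‖f x‖ ^ 2) := by
    filter_upwards [Measure.ae_ne volume (0 : E3)] with x hx
    exact gradSq_sqrt_norm_smul (hf.differentiable (by simp) x) hx
  have hGP : Integrable fun x =>
      ‖x‖ * gradSq f x + ‖x‖⁻¹ * inner ℝ (f x) (fderiv ℝ f x x) := hG.add hP
  rw [integral_congr_ae hae, integral_add hGP (hV.const_mul _), integral_add hG hP,
    integral_const_mul, integral_inv_norm_mul_inner_fderiv_self hf hs]
  ring

end IntegralIdentities

/-- Lieb's anticommutator inequality, a recast of Hardy's inequality: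
for f ∈ C_c^∞(ℝ³), f ≠ 0, one has Re ∫ [ conj f · (−Δ(|·|f)) + |x| conj f · (−Δf) ] > 0;
equivalently ∫ |∇(√|x| f)|² − (1/4)∫ |f|²/|x| > 0. -/
theorem lieb_anticommutator_hardy (f : E3 → ℂ)
    (hf : ContDiff ℝ (⊤ : ℕ∞) f) (hsupp : HasCompactSupport f) (hne : f ≠ 0) :
    0 < (∫ x : E3,
          ((starRingEnd ℂ) (f x) * (-(lapC (fun y : E3 => (‖y‖ : ℂ) * f y) x))
            + (‖x‖ : ℂ) * (starRingEnd ℂ) (f x) * (-(lapC f x)))).re ∧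
    0 < (∫ x : E3, ∑ i : Fin 3,
          ‖fderiv ℝ (fun y : E3 => (Real.sqrt ‖y‖ : ℂ) * f y) x
              (EuclideanSpace.single i 1)‖ ^ 2)
        - (1/4) * ∫ x : E3, ‖f x‖ ^ 2 / ‖x‖ := by
  have hf2 : ContDiff ℝ 2 f := contDiff_infty.1 hf 2
  have hf1 : ContDiff ℝ 1 f := hf2.of_le (by norm_num)
  have hlt := integral_inv_norm_mul_norm_sq_lt hf1 hsupp hne
  constructor
  · rw [integral_anticommutator_re hf2 hsupp]
    linarith
  · have h := integral_gradSq_sqrt_norm_smul hf1 hsupp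
    simp only [gradSq, Complex.real_smul] at h hlt
    simp only [div_eq_inv_mul]
    rw [h]
    linarith
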